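/- arXiv:1712.07393 — 8 statements merged into one kernel-verified Lean document; each statement's English description precedes it below -/
import Mathlib

section
/- With e^k := u^k − u_N^k denoting the primal error, the following a posteriori energy estimate holds: m(e^K, e^K) + Δt·Σ_{k=1}^{K} a(e^k, e^k) ≤ (Δt/α)·Σ_{k=1}^{K} ‖r_N^k‖_{X'}². In particular the discrete space-time energy norm of the primal error is bounded by the estimator Δ_N^u := √((Δt/α)·Σ_{k=1}^{K} ‖r_N^k‖_{X'}²). -/
/-- a posteriori energy estimate for the primal error `e^k = u^k − u_N^k`:
`m(e^K,e^K) + Δt·Σ_{k=1}^{K} a(e^k,e^k) ≤ (Δt/α)·Σ_{k=1}^{K} ‖r_N^k‖_{X'}²`;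
in particular the discrete space-time energy norm of the primal error is bounded by
the estimator `Δ_N^u = √((Δt/α)·Σ_{k=1}^{K} ‖r_N^k‖_{X'}²)`. -/
theorem weighted_rb_stmt2
    {X : Type*} [NormedAddCommGroup X] [InnerProductSpace ℝ X] [CompleteSpace X]
    (m a : X →L[ℝ] X →L[ℝ] ℝ)
    (hm_symm : ∀ v w : X, m v w = m w v)
    (hm_pos : ∀ v : X, 0 ≤ m v v)
    (ha_symm : ∀ v w : X, a v w = a w v)
    (α : ℝ) (hα : 0 < α)
    (ha_coer : ∀ v : X, α * ‖v‖ ^ 2 ≤ a v v)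
    (Δt : ℝ) (hΔt : 0 < Δt)
    (K : ℕ) (hK : 0 < K)
    (b : X →L[ℝ] ℝ)
    (XN : Submodule ℝ X) (hXN : IsClosed (XN : Set X))
    (u : ℕ → X) (hu0 : u 0 = 0)
    (hu : ∀ k : ℕ, 1 ≤ k → k ≤ K → ∀ v : X,
      m (u k) v + Δt * a (u k) v = m (u (k - 1)) v + Δt * b v)
    (uN : ℕ → X) (huN0 : uN 0 = 0) (huNmem : ∀ k : ℕ, uN k ∈ XN)
    (huN : ∀ k : ℕ, 1 ≤ k → k ≤ K → ∀ v ∈ XN,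
      m (uN k) v + Δt * a (uN k) v = m (uN (k - 1)) v + Δt * b v)
    (r : ℕ → (X →L[ℝ] ℝ))
    (hr : ∀ k : ℕ, r k = b - Δt⁻¹ • (m (uN k - uN (k - 1))) - a (uN k)) :
    m (u K - uN K) (u K - uN K)
        + Δt * ∑ k ∈ Finset.Icc 1 K, a (u k - uN k) (u k - uN k)
      ≤ (Δt / α) * ∑ k ∈ Finset.Icc 1 K, ‖r k‖ ^ 2 ∧
    Real.sqrt (m (u K - uN K) (u K - uN K)
        + Δt * ∑ k ∈ Finset.Icc 1 K, a (u k - uN k) (u k - uN k))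
      ≤ Real.sqrt ((Δt / α) * ∑ k ∈ Finset.Icc 1 K, ‖r k‖ ^ 2) := by
  have step : ∀ k : ℕ, k + 1 ≤ K →
      m (u (k+1) - uN (k+1)) (u (k+1) - uN (k+1))
        + Δt * a (u (k+1) - uN (k+1)) (u (k+1) - uN (k+1))
      ≤ m (u k - uN k) (u k - uN k) + Δt / α * ‖r (k+1)‖ ^ 2 := by
    intro k hk
    have h1 := hu (k+1) (by omega) hk (u (k+1) - uN (k+1))
    have h2 : r (k+1) (u (k+1) - uN (k+1)) = b (u (k+1) - uN (k+1))
        - Δt⁻¹ * (m (uN (k+1)) (u (k+1) - uN (k+1)) - m (uN k) (u (k+1) - uN (k+1)))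
        - a (uN (k+1)) (u (k+1) - uN (k+1)) := by
      rw [hr]
      simp only [Nat.add_sub_cancel, sub_apply,
        smul_apply, smul_eq_mul, map_sub]
      ring
    simp only [Nat.add_sub_cancel] at h1
    have h3 := hm_pos ((u (k+1) - uN (k+1)) - (u k - uN k))
    have hs := hm_symm (u k - uN k) (u (k+1) - uN (k+1))
    have hc := ha_coer (u (k+1) - uN (k+1))
    have hn := (le_abs_self _).trans ((r (k+1)).le_opNorm (u (k+1) - uN (k+1)))
    have e1 : m (u (k+1) - uN (k+1)) (u (k+1) - uN (k+1))
        = m (u (k+1)) (u (k+1) - uN (k+1)) - m (uN (k+1)) (u (k+1) - uN (k+1)) := by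
      rw [map_sub m, sub_apply]
    have e2 : a (u (k+1) - uN (k+1)) (u (k+1) - uN (k+1))
        = a (u (k+1)) (u (k+1) - uN (k+1)) - a (uN (k+1)) (u (k+1) - uN (k+1)) := by
      rw [map_sub a, sub_apply]
    have e3 : m (u k - uN k) (u (k+1) - uN (k+1))
        = m (u k) (u (k+1) - uN (k+1)) - m (uN k) (u (k+1) - uN (k+1)) := by
      rw [map_sub m, sub_apply]
    generalize u (k+1) - uN (k+1) = e at *
    generalize u k - uN k = e' at *
    have h4 : m (e - e') (e - e') = m e e - 2 * m e' e + m e' e' := by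
      simp only [map_sub, sub_apply]
      rw [hs]; ring
    have h5 : Δt * r (k+1) e = Δt * b e - (m (uN (k+1)) e - m (uN k) e)
        - Δt * a (uN (k+1)) e := by
      rw [h2]; field_simp
    have h6 : m e e + Δt * a e e = m e' e + Δt * r (k+1) e := by
      rw [h5, e1, e2, e3]; linarith
    have h7 : 2 * r (k+1) e ≤ ‖r (k+1)‖ ^ 2 / α + a e e := by
      have : 2 * (‖r (k+1)‖ * ‖e‖) ≤ ‖r (k+1)‖ ^ 2 / α + α * ‖e‖ ^ 2 := by
        have h8 : ‖r (k+1)‖ ^ 2 / α + α * ‖e‖ ^ 2 - 2 * (‖r (k+1)‖ * ‖e‖)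
            = (‖r (k+1)‖ - α * ‖e‖) ^ 2 / α := by
          field_simp; ring
        have h9 : 0 ≤ (‖r (k+1)‖ - α * ‖e‖) ^ 2 / α := by positivity
        linarith
      linarith
    have h10 := mul_le_mul_of_nonneg_left h7 hΔt.le
    have h11 : Δt / α * ‖r (k+1)‖ ^ 2 = Δt * (‖r (k+1)‖ ^ 2 / α) := by ring
    rw [h11]
    linarith
  have main : ∀ n : ℕ, n ≤ K → m (u n - uN n) (u n - uN n)
        + Δt * ∑ k ∈ Finset.Icc 1 n, a (u k - uN k) (u k - uN k)
      ≤ (Δt / α) * ∑ k ∈ Finset.Icc 1 n, ‖r k‖ ^ 2 := by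
    intro n
    induction n with
    | zero => intro _; simp [hu0, huN0]
    | succ n ih =>
      intro hn
      have h1 := ih (by omega)
      have h2 := step n hn
      rw [Finset.sum_Icc_succ_top (by omega), Finset.sum_Icc_succ_top (by omega),
        mul_add, mul_add]
      linarith
  exact ⟨main K le_rfl, Real.sqrt_le_sqrt (main K le_rfl)⟩
end

section
/- With ẽ^k := ψ^k − ψ̃^k denoting the dual error, the following backward-in-time a posteriori energy estimate holds: m(ẽ^0, ẽ^0) + Δt·Σ_{k=0}^{K−1} a(ẽ^k, ẽ^k) ≤ (Δt/α)·Σ_{k=0}^{K−1} ‖r̃^k‖_{X'}² + Δ_fc². In particular the discrete space-time energy norm of the dual error is bounded by the estimator Δ_Ñ^ψ := √((Δt/α)·Σ_{k=0}^{K−1} ‖r̃^k‖_{X'}² + Δ_fc²). -/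
/-- backward-in-time a posteriori energy estimate for the dual error
`ẽ^k = ψ^k − ψ̃^k`:
`m(ẽ^0,ẽ^0) + Δt·Σ_{k=0}^{K−1} a(ẽ^k,ẽ^k) ≤ (Δt/α)·Σ_{k=0}^{K−1} ‖r̃^k‖_{X'}² + Δ_fc²`;
in particular the discrete space-time energy norm of the dual error is bounded by the
estimator `Δ_Ñ^ψ = √((Δt/α)·Σ_{k=0}^{K−1} ‖r̃^k‖_{X'}² + Δ_fc²)`. -/
theorem weighted_rb_stmt3
    {X : Type*} [NormedAddCommGroup X] [InnerProductSpace ℝ X] [CompleteSpace X]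
    (m a : X →L[ℝ] X →L[ℝ] ℝ)
    (hm_symm : ∀ v w : X, m v w = m w v)
    (hm_pos : ∀ v : X, 0 ≤ m v v)
    (ha_symm : ∀ v w : X, a v w = a w v)
    (α : ℝ) (hα : 0 < α)
    (ha_coer : ∀ v : X, α * ‖v‖ ^ 2 ≤ a v v)
    (Δt : ℝ) (hΔt : 0 < Δt)
    (K : ℕ) (hK : 0 < K)
    (l : X →L[ℝ] ℝ)
    (ψ : ℕ → X)
    (hψK : ∀ v : X, m v (ψ K) = l v)
    (hψ : ∀ k : ℕ, k < K → ∀ v : X,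
      m v (ψ k) + Δt * a v (ψ k) = m v (ψ (k + 1)))
    (Xt : Submodule ℝ X) (hXt : IsClosed (Xt : Set X))
    (ψt : ℕ → X) (hψtmem : ∀ k : ℕ, ψt k ∈ Xt)
    (hψtK : ∀ v ∈ Xt, m v (ψt K) = l v)
    (hψt : ∀ k : ℕ, k < K → ∀ v ∈ Xt,
      m v (ψt k) + Δt * a v (ψt k) = m v (ψt (k + 1)))
    (rt : ℕ → (X →L[ℝ] ℝ))
    (hrt : ∀ k : ℕ, rt k = -(Δt⁻¹ • (m.flip (ψt k - ψt (k + 1)))) - a.flip (ψt k))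
    (Δfc : ℝ) (hΔfc0 : 0 ≤ Δfc)
    (hΔfc : m (ψ K - ψt K) (ψ K - ψt K) ≤ Δfc ^ 2) :
    m (ψ 0 - ψt 0) (ψ 0 - ψt 0)
        + Δt * ∑ k ∈ Finset.range K, a (ψ k - ψt k) (ψ k - ψt k)
      ≤ (Δt / α) * ∑ k ∈ Finset.range K, ‖rt k‖ ^ 2 + Δfc ^ 2 ∧
    Real.sqrt (m (ψ 0 - ψt 0) (ψ 0 - ψt 0)
        + Δt * ∑ k ∈ Finset.range K, a (ψ k - ψt k) (ψ k - ψt k))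
      ≤ Real.sqrt ((Δt / α) * ∑ k ∈ Finset.range K, ‖rt k‖ ^ 2 + Δfc ^ 2) := by
  have step : ∀ k : ℕ, k < K →
      m (ψ k - ψt k) (ψ k - ψt k) + Δt * a (ψ k - ψt k) (ψ k - ψt k)
        ≤ Δt / α * ‖rt k‖ ^ 2
          + m (ψ (k + 1) - ψt (k + 1)) (ψ (k + 1) - ψt (k + 1)) := by
    intro k hk
    have hr : ∀ v : X, Δt * rt k v
        = -(m v (ψt k) - m v (ψt (k + 1))) - Δt * a v (ψt k) := by
      intro v
      rw [hrt k]
      simp only [sub_apply, neg_apply, smul_apply, ContinuousLinearMap.sub_apply,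
        ContinuousLinearMap.neg_apply, ContinuousLinearMap.smul_apply,
        ContinuousLinearMap.flip_apply, map_sub, smul_eq_mul]
      field_simp
    have herr : m (ψ k - ψt k) (ψ k - ψt k) + Δt * a (ψ k - ψt k) (ψ k - ψt k)
        = m (ψ k - ψt k) (ψ (k + 1) - ψt (k + 1)) + Δt * rt k (ψ k - ψt k) := by
      have h1 := hψ k hk (ψ k - ψt k)
      have h2 := hr (ψ k - ψt k)
      rw [map_sub (m (ψ k - ψt k)) (ψ k) (ψt k), map_sub (a (ψ k - ψt k)) (ψ k) (ψt k),
        map_sub (m (ψ k - ψt k)) (ψ (k + 1)) (ψt (k + 1))]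
      linarith
    generalize ψ k - ψt k = e at *
    generalize ψ (k + 1) - ψt (k + 1) = f at *
    have hcs : 2 * m e f ≤ m e e + m f f := by
      have h := hm_pos (e - f)
      have h' : m (e - f) (e - f) = m e e - m e f - (m f e - m f f) := by
        simp only [map_sub, sub_apply, ContinuousLinearMap.sub_apply]
        ring
      have := hm_symm e f
      linarith
    have hre : 2 * rt k e ≤ ‖rt k‖ ^ 2 / α + a e e := by
      have h1 : rt k e ≤ ‖rt k‖ * ‖e‖ := (le_abs_self _).trans ((rt k).le_opNorm e)
      have h2 := ha_coer e
      have h3 : 2 * (‖rt k‖ * ‖e‖) ≤ ‖rt k‖ ^ 2 / α + α * ‖e‖ ^ 2 := by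
        have h4 : ‖rt k‖ ^ 2 / α + α * ‖e‖ ^ 2 - 2 * (‖rt k‖ * ‖e‖)
            = (‖rt k‖ - α * ‖e‖) ^ 2 / α := by
          field_simp
          ring
        have h5 : 0 ≤ (‖rt k‖ - α * ‖e‖) ^ 2 / α := by positivity
        linarith
      linarith
    have hre' := mul_le_mul_of_nonneg_left hre hΔt.le
    have h6 : Δt / α * ‖rt k‖ ^ 2 = Δt * (‖rt k‖ ^ 2 / α) := by ring
    rw [h6]
    nlinarith
  have main : ∀ n : ℕ, n ≤ K →
      m (ψ 0 - ψt 0) (ψ 0 - ψt 0)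
        + Δt * ∑ k ∈ Finset.range n, a (ψ k - ψt k) (ψ k - ψt k)
      ≤ (Δt / α) * ∑ k ∈ Finset.range n, ‖rt k‖ ^ 2 + m (ψ n - ψt n) (ψ n - ψt n) := by
    intro n
    induction n with
    | zero => intro _; simp
    | succ n ih =>
      intro hn
      have h1 := ih (by omega)
      have h2 := step n (by omega)
      rw [Finset.sum_range_succ, Finset.sum_range_succ, mul_add, mul_add]
      linarith
  have h : m (ψ 0 - ψt 0) (ψ 0 - ψt 0)
        + Δt * ∑ k ∈ Finset.range K, a (ψ k - ψt k) (ψ k - ψt k)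
      ≤ (Δt / α) * ∑ k ∈ Finset.range K, ‖rt k‖ ^ 2 + Δfc ^ 2 := by
    linarith [main K le_rfl]
  exact ⟨h, Real.sqrt_le_sqrt h⟩
end

section
/- The output error admits the exact representation l(u^K − u_N^K) = Δt·Σ_{k=1}^{K} r_N^k(ψ^{k−1}). Consequently, defining the detailed output s_h := l(u^K) and the adjoint-corrected reduced output s_N := l(u_N^K) + Δt·Σ_{k=1}^{K} r_N^k(ψ̃^{k−1}), one has s_h − s_N = Δt·Σ_{k=1}^{K} r_N^k(ψ^{k−1} − ψ̃^{k−1}). -/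
/-- exact output error representation
`l(u^K − u_N^K) = Δt·Σ_{k=1}^{K} r_N^k(ψ^{k−1})`; consequently, with
`s_h = l(u^K)` and `s_N = l(u_N^K) + Δt·Σ_{k=1}^{K} r_N^k(ψ̃^{k−1})`,
`s_h − s_N = Δt·Σ_{k=1}^{K} r_N^k(ψ^{k−1} − ψ̃^{k−1})`. -/
theorem weighted_rb_stmt5
    {X : Type*} [NormedAddCommGroup X] [InnerProductSpace ℝ X] [CompleteSpace X]
    (m a : X →L[ℝ] X →L[ℝ] ℝ)
    (hm_symm : ∀ v w : X, m v w = m w v)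
    (hm_pos : ∀ v : X, 0 ≤ m v v)
    (ha_symm : ∀ v w : X, a v w = a w v)
    (α : ℝ) (hα : 0 < α)
    (ha_coer : ∀ v : X, α * ‖v‖ ^ 2 ≤ a v v)
    (Δt : ℝ) (hΔt : 0 < Δt)
    (K : ℕ) (hK : 0 < K)
    (b : X →L[ℝ] ℝ)
    (u : ℕ → X) (hu0 : u 0 = 0)
    (hu : ∀ k : ℕ, 1 ≤ k → k ≤ K → ∀ v : X,
      m (u k) v + Δt * a (u k) v = m (u (k - 1)) v + Δt * b v)
    (XN : Submodule ℝ X) (hXN : IsClosed (XN : Set X))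
    (uN : ℕ → X) (huN0 : uN 0 = 0) (huNmem : ∀ k : ℕ, uN k ∈ XN)
    (huN : ∀ k : ℕ, 1 ≤ k → k ≤ K → ∀ v ∈ XN,
      m (uN k) v + Δt * a (uN k) v = m (uN (k - 1)) v + Δt * b v)
    (r : ℕ → (X →L[ℝ] ℝ))
    (hr : ∀ k : ℕ, r k = b - Δt⁻¹ • (m (uN k - uN (k - 1))) - a (uN k))
    (l : X →L[ℝ] ℝ)
    (ψ : ℕ → X)
    (hψK : ∀ v : X, m v (ψ K) = l v)
    (hψ : ∀ k : ℕ, k < K → ∀ v : X,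
      m v (ψ k) + Δt * a v (ψ k) = m v (ψ (k + 1)))
    (Xt : Submodule ℝ X) (hXt : IsClosed (Xt : Set X))
    (ψt : ℕ → X) (hψtmem : ∀ k : ℕ, ψt k ∈ Xt)
    (hψtK : ∀ v ∈ Xt, m v (ψt K) = l v)
    (hψt : ∀ k : ℕ, k < K → ∀ v ∈ Xt,
      m v (ψt k) + Δt * a v (ψt k) = m v (ψt (k + 1))) :
    l (u K - uN K) = Δt * ∑ k ∈ Finset.Icc 1 K, r k (ψ (k - 1)) ∧
    l (u K) - (l (uN K) + Δt * ∑ k ∈ Finset.Icc 1 K, r k (ψt (k - 1)))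
      = Δt * ∑ k ∈ Finset.Icc 1 K, r k (ψ (k - 1) - ψt (k - 1)) := by
  have key : ∀ n : ℕ, n ≤ K →
      m (u n - uN n) (ψ n) = Δt * ∑ k ∈ Finset.Icc 1 n, r k (ψ (k - 1)) := by
    intro n
    induction n with
    | zero => intro _; simp [hu0, huN0]
    | succ n ih =>
      intro hn
      have ih' := ih (by omega)
      have h1 := hu (n + 1) (by omega) hn (ψ n)
      have h2 := hψ n (by omega) (u (n + 1))
      have h3 := hψ n (by omega) (uN (n + 1))
      have h4 : Δt * r (n + 1) (ψ n) = Δt * b (ψ n)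
          - (m (uN (n + 1)) (ψ n) - m (uN n) (ψ n)) - Δt * a (uN (n + 1)) (ψ n) := by
        rw [hr]
        simp only [Nat.add_sub_cancel, map_sub, ContinuousLinearMap.sub_apply,
          ContinuousLinearMap.smul_apply, smul_eq_mul]
        field_simp
      rw [Finset.sum_Icc_succ_top (by omega), mul_add, ← ih']
      simp only [Nat.add_sub_cancel, map_sub, ContinuousLinearMap.sub_apply] at h1 ⊢
      linarith
  have first : l (u K - uN K) = Δt * ∑ k ∈ Finset.Icc 1 K, r k (ψ (k - 1)) := by
    rw [← hψK]
    exact key K le_rfl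
  refine ⟨first, ?_⟩
  simp only [map_sub, Finset.sum_sub_distrib, mul_sub] at first ⊢
  linarith
end

section
/- If the reduced dual solutions coincide with the detailed dual solutions, i.e. ψ̃^k = ψ^k for k = 0,…,K−1, then the adjoint-corrected reduced output is exact: s_N := l(u_N^K) + Δt·Σ_{k=1}^{K} r_N^k(ψ̃^{k−1}) equals the detailed output s_h := l(u^K), regardless of the reduced primal space X_N. -/
/-- if the reduced dual solutions coincide with the detailed dual
solutions, `ψ̃^k = ψ^k` for `k = 0,…,K−1`, then the adjoint-corrected reduced output
`s_N = l(u_N^K) + Δt·Σ_{k=1}^{K} r_N^k(ψ̃^{k−1})` equals the detailed output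
`s_h = l(u^K)`, regardless of the reduced primal space `X_N`. -/
theorem weighted_rb_stmt6
    {X : Type*} [NormedAddCommGroup X] [InnerProductSpace ℝ X] [CompleteSpace X]
    (m a : X →L[ℝ] X →L[ℝ] ℝ)
    (hm_symm : ∀ v w : X, m v w = m w v)
    (hm_pos : ∀ v : X, 0 ≤ m v v)
    (ha_symm : ∀ v w : X, a v w = a w v)
    (α : ℝ) (hα : 0 < α)
    (ha_coer : ∀ v : X, α * ‖v‖ ^ 2 ≤ a v v)
    (Δt : ℝ) (hΔt : 0 < Δt)
    (K : ℕ) (hK : 0 < K)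
    (b : X →L[ℝ] ℝ)
    (u : ℕ → X) (hu0 : u 0 = 0)
    (hu : ∀ k : ℕ, 1 ≤ k → k ≤ K → ∀ v : X,
      m (u k) v + Δt * a (u k) v = m (u (k - 1)) v + Δt * b v)
    (XN : Submodule ℝ X) (hXN : IsClosed (XN : Set X))
    (uN : ℕ → X) (huN0 : uN 0 = 0) (huNmem : ∀ k : ℕ, uN k ∈ XN)
    (huN : ∀ k : ℕ, 1 ≤ k → k ≤ K → ∀ v ∈ XN,
      m (uN k) v + Δt * a (uN k) v = m (uN (k - 1)) v + Δt * b v)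
    (r : ℕ → (X →L[ℝ] ℝ))
    (hr : ∀ k : ℕ, r k = b - Δt⁻¹ • (m (uN k - uN (k - 1))) - a (uN k))
    (l : X →L[ℝ] ℝ)
    (ψ : ℕ → X)
    (hψK : ∀ v : X, m v (ψ K) = l v)
    (hψ : ∀ k : ℕ, k < K → ∀ v : X,
      m v (ψ k) + Δt * a v (ψ k) = m v (ψ (k + 1)))
    (ψt : ℕ → X)
    (hψtψ : ∀ k : ℕ, k < K → ψt k = ψ k) :
    l (uN K) + Δt * ∑ k ∈ Finset.Icc 1 K, r k (ψt (k - 1)) = l (u K) := by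
  have key : ∀ j : ℕ, j ≤ K →
      Δt * ∑ k ∈ Finset.Icc 1 j, r k (ψt (k - 1)) = m (u j) (ψ j) - m (uN j) (ψ j) := by
    intro j
    induction j with
    | zero => intro _; simp [hu0, huN0]
    | succ j ih =>
      intro hj
      have h0 := ih (by omega)
      have h1 := hu (j + 1) (by omega) hj (ψ j)
      have h2 := hψ j (by omega) (u (j + 1))
      have h3 := hψ j (by omega) (uN (j + 1))
      have h4 : Δt * r (j + 1) (ψ j) = Δt * b (ψ j) - (m (uN (j + 1)) (ψ j) - m (uN j) (ψ j))
          - Δt * a (uN (j + 1)) (ψ j) := by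
        rw [hr]
        simp only [Nat.add_sub_cancel, map_sub, sub_apply, smul_apply, smul_eq_mul]
        field_simp
      rw [Finset.sum_Icc_succ_top (by omega), mul_add, h0]
      simp only [Nat.add_sub_cancel] at h1 ⊢
      rw [hψtψ j (by omega), h4]
      linarith
  rw [key K le_rfl, hψK, hψK]
  ring
end

section
/- The adjoint-corrected output error satisfies the primal–dual a posteriori bound |s_h − s_N| ≤ Δ_N^u · Δ_Ñ^ψ, where s_h := l(u^K), s_N := l(u_N^K) + Δt·Σ_{k=1}^{K} r_N^k(ψ̃^{k−1}), Δ_N^u := √((Δt/α)·Σ_{k=1}^{K} ‖r_N^k‖_{X'}²), and Δ_Ñ^ψ := √((Δt/α)·Σ_{k=0}^{K−1} ‖r̃^k‖_{X'}² + Δ_fc²). -/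
/-- primal–dual a posteriori bound for the adjoint-corrected output:
`|s_h − s_N| ≤ Δ_N^u · Δ_Ñ^ψ` with `s_h = l(u^K)`,
`s_N = l(u_N^K) + Δt·Σ_{k=1}^{K} r_N^k(ψ̃^{k−1})`,
`Δ_N^u = √((Δt/α)·Σ_{k=1}^{K} ‖r_N^k‖²)` and
`Δ_Ñ^ψ = √((Δt/α)·Σ_{k=0}^{K−1} ‖r̃^k‖² + Δ_fc²)`. -/
theorem weighted_rb_stmt7
    {X : Type*} [NormedAddCommGroup X] [InnerProductSpace ℝ X] [CompleteSpace X]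
    (m a : X →L[ℝ] X →L[ℝ] ℝ)
    (hm_symm : ∀ v w : X, m v w = m w v)
    (hm_pos : ∀ v : X, 0 ≤ m v v)
    (ha_symm : ∀ v w : X, a v w = a w v)
    (α : ℝ) (hα : 0 < α)
    (ha_coer : ∀ v : X, α * ‖v‖ ^ 2 ≤ a v v)
    (Δt : ℝ) (hΔt : 0 < Δt)
    (K : ℕ) (hK : 0 < K)
    (b : X →L[ℝ] ℝ)
    (u : ℕ → X) (hu0 : u 0 = 0)
    (hu : ∀ k : ℕ, 1 ≤ k → k ≤ K → ∀ v : X,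
      m (u k) v + Δt * a (u k) v = m (u (k - 1)) v + Δt * b v)
    (XN : Submodule ℝ X) (hXN : IsClosed (XN : Set X))
    (uN : ℕ → X) (huN0 : uN 0 = 0) (huNmem : ∀ k : ℕ, uN k ∈ XN)
    (huN : ∀ k : ℕ, 1 ≤ k → k ≤ K → ∀ v ∈ XN,
      m (uN k) v + Δt * a (uN k) v = m (uN (k - 1)) v + Δt * b v)
    (r : ℕ → (X →L[ℝ] ℝ))
    (hr : ∀ k : ℕ, r k = b - Δt⁻¹ • (m (uN k - uN (k - 1))) - a (uN k))
    (l : X →L[ℝ] ℝ)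
    (ψ : ℕ → X)
    (hψK : ∀ v : X, m v (ψ K) = l v)
    (hψ : ∀ k : ℕ, k < K → ∀ v : X,
      m v (ψ k) + Δt * a v (ψ k) = m v (ψ (k + 1)))
    (Xt : Submodule ℝ X) (hXt : IsClosed (Xt : Set X))
    (ψt : ℕ → X) (hψtmem : ∀ k : ℕ, ψt k ∈ Xt)
    (hψtK : ∀ v ∈ Xt, m v (ψt K) = l v)
    (hψt : ∀ k : ℕ, k < K → ∀ v ∈ Xt,
      m v (ψt k) + Δt * a v (ψt k) = m v (ψt (k + 1)))
    (rt : ℕ → (X →L[ℝ] ℝ))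
    (hrt : ∀ k : ℕ, rt k = -(Δt⁻¹ • (m.flip (ψt k - ψt (k + 1)))) - a.flip (ψt k))
    (Δfc : ℝ) (hΔfc0 : 0 ≤ Δfc)
    (hΔfc : m (ψ K - ψt K) (ψ K - ψt K) ≤ Δfc ^ 2) :
    |l (u K) - (l (uN K) + Δt * ∑ k ∈ Finset.Icc 1 K, r k (ψt (k - 1)))|
      ≤ Real.sqrt ((Δt / α) * ∑ k ∈ Finset.Icc 1 K, ‖r k‖ ^ 2)
        * Real.sqrt ((Δt / α) * ∑ k ∈ Finset.range K, ‖rt k‖ ^ 2 + Δfc ^ 2) := by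
  have hIcc : ∀ (f : ℕ → ℝ) (n : ℕ),
      ∑ k ∈ Finset.Icc 1 n, f k = ∑ k ∈ Finset.range n, f (k + 1) := by
    intro f n
    induction n with
    | zero => simp
    | succ n ih => rw [Finset.sum_Icc_succ_top (by omega), ih, Finset.sum_range_succ]
  rw [hIcc, hIcc]
  simp only [Nat.add_sub_cancel]
  -- primal error equation
  have hprim : ∀ k, k < K → ∀ v, m (u (k+1) - uN (k+1)) v - m (u k - uN k) v
      + Δt * a (u (k+1) - uN (k+1)) v = Δt * r (k+1) v := by
    intro k hk v
    have h := hu (k+1) (by omega) (by omega) v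
    rw [hr]
    simp only [Nat.add_sub_cancel, map_sub, ContinuousLinearMap.sub_apply,
      ContinuousLinearMap.smul_apply, smul_eq_mul] at h ⊢
    field_simp
    linarith
  have hdual : ∀ k, k < K → ∀ v, m v (ψ k - ψt k) - m v (ψ (k+1) - ψt (k+1))
      + Δt * a v (ψ k - ψt k) = Δt * rt k v := by
    intro k hk v
    have h := hψ k hk v
    rw [hrt]
    simp only [map_sub, ContinuousLinearMap.sub_apply, ContinuousLinearMap.neg_apply,
      ContinuousLinearMap.smul_apply, smul_eq_mul, ContinuousLinearMap.flip_apply] at h ⊢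
    field_simp
    linarith
  -- output representation
  have hrep : ∀ n, n ≤ K → m (u n - uN n) (ψ n)
      = Δt * ∑ k ∈ Finset.range n, r (k+1) (ψ k) := by
    intro n
    induction n with
    | zero => intro _; simp [hu0, huN0]
    | succ n ih =>
      intro hn
      have h1 := ih (by omega)
      have h2 := hprim n (by omega) (ψ n)
      have h3 := hψ n (by omega) (u (n+1) - uN (n+1))
      rw [Finset.sum_range_succ, mul_add]
      linarith
  have herr : l (u K) - (l (uN K) + Δt * ∑ k ∈ Finset.range K, r (k+1) (ψt k))
      = Δt * ∑ k ∈ Finset.range K, r (k+1) (ψ k - ψt k) := by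
    have h1 := hrep K le_rfl
    rw [hψK] at h1
    simp only [map_sub, Finset.sum_sub_distrib] at h1 ⊢
    linarith
  -- dual energy estimate
  have hstep : ∀ k, k < K → m (ψ k - ψt k) (ψ k - ψt k)
      - m (ψ (k+1) - ψt (k+1)) (ψ (k+1) - ψt (k+1)) + Δt * α * ‖ψ k - ψt k‖ ^ 2
      ≤ Δt / α * ‖rt k‖ ^ 2 := by
    intro k hk
    have h1 := hdual k hk (ψ k - ψt k)
    generalize ψ k - ψt k = x at *
    generalize ψ (k+1) - ψt (k+1) = y at *
    have h2 := hm_pos (x - y)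
    have h3 := hm_symm x y
    simp only [map_sub, ContinuousLinearMap.sub_apply] at h2
    have h4 : rt k x ≤ ‖rt k‖ * ‖x‖ := (le_abs_self _).trans ((rt k).le_opNorm x)
    have h5 := ha_coer x
    have h6 : 2 * (‖rt k‖ * ‖x‖) ≤ ‖rt k‖ ^ 2 / α + α * ‖x‖ ^ 2 := by
      have h : ‖rt k‖ ^ 2 / α + α * ‖x‖ ^ 2 - 2 * (‖rt k‖ * ‖x‖)
          = (‖rt k‖ - α * ‖x‖) ^ 2 / α := by field_simp; ring
      have : 0 ≤ (‖rt k‖ - α * ‖x‖) ^ 2 / α := by positivity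
      linarith
    have h7 : Δt * (2 * rt k x - 2 * a x x + α * ‖x‖ ^ 2) ≤ Δt * (‖rt k‖ ^ 2 / α) :=
      mul_le_mul_of_nonneg_left (by linarith) hΔt.le
    have h8 : Δt / α * ‖rt k‖ ^ 2 = Δt * (‖rt k‖ ^ 2 / α) := by ring
    rw [h8]
    linarith
  have hsum : ∀ n, n ≤ K → m (ψ 0 - ψt 0) (ψ 0 - ψt 0) - m (ψ n - ψt n) (ψ n - ψt n)
      + Δt * α * ∑ k ∈ Finset.range n, ‖ψ k - ψt k‖ ^ 2
      ≤ Δt / α * ∑ k ∈ Finset.range n, ‖rt k‖ ^ 2 := by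
    intro n
    induction n with
    | zero => intro _; simp
    | succ n ih =>
      intro hn
      have h1 := ih (by omega)
      have h2 := hstep n (by omega)
      rw [Finset.sum_range_succ, Finset.sum_range_succ, mul_add, mul_add]
      linarith
  have henergy : Δt * α * ∑ k ∈ Finset.range K, ‖ψ k - ψt k‖ ^ 2
      ≤ Δt / α * ∑ k ∈ Finset.range K, ‖rt k‖ ^ 2 + Δfc ^ 2 := by
    have h1 := hsum K le_rfl
    have h2 := hm_pos (ψ 0 - ψt 0)
    linarith
  rw [herr, ← Real.sqrt_mul (by positivity)]
  apply Real.abs_le_sqrt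
  have habs : |∑ k ∈ Finset.range K, r (k+1) (ψ k - ψt k)|
      ≤ ∑ k ∈ Finset.range K, ‖r (k+1)‖ * ‖ψ k - ψt k‖ :=
    (Finset.abs_sum_le_sum_abs _ _).trans
      (Finset.sum_le_sum fun k _ => (r (k+1)).le_opNorm _)
  have hsq : (∑ k ∈ Finset.range K, r (k+1) (ψ k - ψt k)) ^ 2
      ≤ (∑ k ∈ Finset.range K, ‖r (k+1)‖ ^ 2) * ∑ k ∈ Finset.range K, ‖ψ k - ψt k‖ ^ 2 := by
    rw [← sq_abs]
    exact (pow_le_pow_left₀ (abs_nonneg _) habs 2).trans (Finset.sum_mul_sq_le_sq_mul_sq _ _ _)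
  calc (Δt * ∑ k ∈ Finset.range K, r (k+1) (ψ k - ψt k)) ^ 2
      = Δt ^ 2 * (∑ k ∈ Finset.range K, r (k+1) (ψ k - ψt k)) ^ 2 := by ring
    _ ≤ Δt ^ 2 * ((∑ k ∈ Finset.range K, ‖r (k+1)‖ ^ 2)
        * ∑ k ∈ Finset.range K, ‖ψ k - ψt k‖ ^ 2) := by gcongr
    _ = (Δt / α * ∑ k ∈ Finset.range K, ‖r (k+1)‖ ^ 2)
        * (Δt * α * ∑ k ∈ Finset.range K, ‖ψ k - ψt k‖ ^ 2) := by field_simp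
    _ ≤ _ := mul_le_mul_of_nonneg_left henergy (by positivity)
end

section
/- (Ky Fan maximum principle, as used for POD optimality.) For every orthonormal family φ_1,…,φ_N in X with N ≤ M, one has Σ_{n=1}^{N} ⟨R φ_n, φ_n⟩ ≤ Σ_{n=1}^{N} λ_n, with equality when φ_1,…,φ_N are orthonormal eigenvectors of R corresponding to the eigenvalues λ_1,…,λ_N. -/
open RealInnerProductSpace

/-- Ky Fan maximum principle, as used for POD optimality: for every
orthonormal family `φ_1,…,φ_N` (`N ≤ M`) one has
`Σ_n ⟪R φ_n, φ_n⟫ ≤ Σ_{n=1}^{N} λ_n`, with equality when `φ_1,…,φ_N` are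
orthonormal eigenvectors of `R` for the eigenvalues `λ_1,…,λ_N`. Here
`R v = Σ_j ⟪v, y_j⟫ y_j` and `λ_1 ≥ … ≥ λ_M ≥ 0` lists every nonzero eigenvalue of
`R` with multiplicity (padded with zeros), encoded by the eigenfamily `e`. -/
theorem weighted_rb_stmt11
    {X : Type*} [NormedAddCommGroup X] [InnerProductSpace ℝ X] [FiniteDimensional ℝ X]
    (M : ℕ) (y : Fin M → X)
    (R : X → X) (hR : ∀ v : X, R v = ∑ j : Fin M, ⟪v, y j⟫ • y j)
    (lam : Fin M → ℝ) (hlam_anti : Antitone lam) (hlam_nonneg : ∀ l, 0 ≤ lam l)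
    (e : Fin M → X)
    (he_eig : ∀ l, R (e l) = lam l • e l)
    (he_norm : ∀ l, lam l ≠ 0 → ‖e l‖ = 1)
    (he_orth : ∀ l l', l ≠ l' → ⟪e l, e l'⟫ = 0)
    (he_span : ∀ v : X, (∀ l, ⟪v, e l⟫ = 0) → R v = 0)
    (N : ℕ) (hNM : N ≤ M) :
    (∀ φ : Fin N → X, Orthonormal ℝ φ →
      ∑ n : Fin N, ⟪R (φ n), φ n⟫ ≤ ∑ n : Fin N, lam (Fin.castLE hNM n)) ∧
    (∀ φ : Fin N → X, Orthonormal ℝ φ →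
      (∀ n : Fin N, R (φ n) = lam (Fin.castLE hNM n) • φ n) →
      ∑ n : Fin N, ⟪R (φ n), φ n⟫ = ∑ n : Fin N, lam (Fin.castLE hNM n)) := by
  refine ⟨?_, ?_⟩
  swap
  · intro φ hφ h
    refine Finset.sum_congr rfl fun n _ => ?_
    rw [h n, real_inner_smul_left, real_inner_self_eq_norm_sq, hφ.1 n]
    ring
  intro φ hφ
  -- normalised eigenfamily
  obtain ⟨u, hu⟩ : ∃ u : Fin M → X, ∀ l, u l = (‖e l‖⁻¹) • e l := ⟨_, fun _ => rfl⟩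
  have hue : ∀ l, lam l ≠ 0 → u l = e l := by
    intro l hl
    rw [hu, he_norm l hl]; simp
  have hu_orth : ∀ l l', l ≠ l' → ⟪u l, u l'⟫ = 0 := by
    intro l l' h
    rw [hu, hu, real_inner_smul_left, real_inner_smul_right, he_orth l l' h]; simp
  have hu_norm : ∀ l, ‖u l‖ ≤ 1 := by
    intro l
    rw [hu, norm_smul, norm_inv, norm_norm]
    exact inv_mul_le_one
  have hu_eig : ∀ l, R (u l) = lam l • u l := by
    intro l
    have : R (u l) = ‖e l‖⁻¹ • R (e l) := by
      rw [hR, hR, hu, Finset.smul_sum]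
      refine Finset.sum_congr rfl fun j _ => ?_
      rw [real_inner_smul_left, mul_smul]
    rw [this, he_eig, hu, smul_comm]
  have hu_self : ∀ l, ∀ v : X, ⟪v, u l⟫ * ⟪u l, u l⟫ = ⟪v, u l⟫ := by
    intro l v
    by_cases h : e l = 0
    · simp [hu, h]
    · have h1 : ‖u l‖ = 1 := by
        rw [hu, norm_smul, norm_inv, norm_norm, inv_mul_cancel₀ (norm_ne_zero_iff.2 h)]
      rw [real_inner_self_eq_norm_sq, h1]; ring
  have hw : ∀ v : X, ∀ l, ⟪v - ∑ k, ⟪v, u k⟫ • u k, u l⟫ = 0 := by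
    intro v l
    rw [inner_sub_left, sum_inner, Finset.sum_eq_single l]
    · rw [real_inner_smul_left, hu_self, sub_self]
    · intro k _ hk
      rw [real_inner_smul_left, hu_orth k l hk, mul_zero]
    · simp
  have hwe : ∀ v : X, ∀ l, ⟪v - ∑ k, ⟪v, u k⟫ • u k, e l⟫ = 0 := by
    intro v l
    by_cases h : e l = 0
    · simp [h]
    · have := hw v l
      rw [hu l, real_inner_smul_right] at this
      exact (mul_eq_zero.1 this).resolve_left (inv_ne_zero (norm_ne_zero_iff.2 h))
  have hbessel : ∀ v : X, ∑ l, ⟪v, u l⟫ ^ 2 ≤ ‖v‖ ^ 2 := by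
    intro v
    obtain ⟨w, hwd⟩ : ∃ w, w = v - ∑ k, ⟪v, u k⟫ • u k := ⟨_, rfl⟩
    have h0 : ∀ l, ⟪w, u l⟫ = 0 := by rw [hwd]; exact hw v
    have h1 : ⟪w, v⟫ = ⟪w, w⟫ := by
      conv_rhs => rw [hwd, inner_sub_right, ← hwd]
      rw [inner_sum]
      simp [real_inner_smul_right, h0]
    have h2 : ⟪w, v⟫ = ‖v‖ ^ 2 - ∑ l, ⟪v, u l⟫ ^ 2 := by
      rw [hwd, inner_sub_left, real_inner_self_eq_norm_sq, sum_inner]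
      congr 1
      refine Finset.sum_congr rfl fun l _ => ?_
      rw [real_inner_smul_left, real_inner_comm, sq, real_inner_comm]
    have h3 : 0 ≤ ⟪w, w⟫ := real_inner_self_nonneg
    linarith
  -- R as a linear map
  obtain ⟨L, hL⟩ : ∃ L : X →ₗ[ℝ] X, ∀ v, L v = R v := by
    refine ⟨{ toFun := R, map_add' := ?_, map_smul' := ?_ }, fun _ => rfl⟩
    · intro a b
      simp only [hR, inner_add_left, add_smul, Finset.sum_add_distrib]
    · intro c a
      simp only [hR, real_inner_smul_left, mul_smul, Finset.smul_sum, RingHom.id_apply]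
  have hquad : ∀ v : X, ⟪R v, v⟫ = ∑ l, lam l * ⟪v, u l⟫ ^ 2 := by
    intro v
    have h0 := he_span _ (hwe v)
    rw [← hL, map_sub, sub_eq_zero, hL, map_sum] at h0
    rw [h0, sum_inner]
    refine Finset.sum_congr rfl fun l _ => ?_
    rw [map_smul, hL, hu_eig, real_inner_smul_left, real_inner_smul_left,
      real_inner_comm v (u l)]
    ring
  obtain ⟨a, ha⟩ : ∃ a : Fin M → ℝ, ∀ l, a l = ∑ n, ⟪φ n, u l⟫ ^ 2 := ⟨_, fun _ => rfl⟩
  have ha0 : ∀ l, 0 ≤ a l := fun l => by rw [ha]; positivity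
  have ha1 : ∀ l, a l ≤ 1 := by
    intro l
    have h := hφ.sum_inner_products_le (u l) (s := Finset.univ)
    simp only [Real.norm_eq_abs, sq_abs] at h
    rw [ha]
    have := hu_norm l
    have h0 := norm_nonneg (u l)
    nlinarith
  have haN : ∑ l, a l ≤ N := by
    simp only [ha]
    rw [Finset.sum_comm]
    calc _ ≤ ∑ n : Fin N, (1 : ℝ) := by
          refine Finset.sum_le_sum fun n _ => ?_
          have := hbessel (φ n)
          rwa [hφ.1 n, one_pow] at this
      _ = N := by simp
  have hsum : ∑ n : Fin N, ⟪R (φ n), φ n⟫ = ∑ l, lam l * a l := by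
    simp only [hquad, ha, Finset.mul_sum]
    rw [Finset.sum_comm]
  rw [hsum]
  clear hsum hquad hL hbessel hwe hw hu_self hu_eig hu_norm hu_orth hue hu ha he_span he_orth
    he_norm he_eig hR hφ
  obtain ⟨k, rfl⟩ := Nat.exists_eq_add_of_le hNM
  -- threshold value
  obtain ⟨μ, hμ0, hμ1, hμ2⟩ : ∃ μ : ℝ, 0 ≤ μ * (N - ∑ l, a l) ∧
      (∀ n : Fin N, μ ≤ lam (Fin.castAdd k n)) ∧ ∀ n : Fin k, lam (Fin.natAdd N n) * a (Fin.natAdd N n) ≤ μ * a (Fin.natAdd N n) := by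
    rcases Nat.eq_zero_or_pos N with h | h
    · subst h
      refine ⟨0, by simp, fun n => n.elim0, fun n => ?_⟩
      have h1 : ∑ l, a l = 0 := le_antisymm (by simpa using haN) (Finset.sum_nonneg fun l _ => ha0 l)
      have := (Finset.sum_eq_zero_iff_of_nonneg (fun l _ => ha0 l)).1 h1 (Fin.natAdd 0 n) (Finset.mem_univ _)
      rw [this, mul_zero, mul_zero]
    · refine ⟨lam (Fin.castAdd k ⟨N - 1, by omega⟩), ?_, ?_, ?_⟩
      · exact mul_nonneg (hlam_nonneg _) (by linarith)
      · intro n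
        apply hlam_anti
        rw [Fin.le_def]; simp; omega
      · intro n
        apply mul_le_mul_of_nonneg_right _ (ha0 _)
        apply hlam_anti
        rw [Fin.le_def]; simp; omega
  change _ ≤ ∑ n : Fin N, lam (Fin.castAdd k n)
  rw [Fin.sum_univ_add] at hμ0 ⊢
  have hA : ∑ n : Fin N, lam (Fin.castAdd k n) * a (Fin.castAdd k n) ≤
      ∑ n : Fin N, (lam (Fin.castAdd k n) - μ + μ * a (Fin.castAdd k n)) := by
    refine Finset.sum_le_sum fun n _ => ?_
    nlinarith [hμ1 n, ha1 (Fin.castAdd k n)]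
  have hB := Finset.sum_le_sum (s := Finset.univ) fun n _ => hμ2 n
  rw [← Finset.mul_sum] at hB
  rw [Finset.sum_add_distrib, Finset.sum_sub_distrib, ← Finset.mul_sum] at hA
  simp only [Finset.sum_const, Finset.card_univ, Fintype.card_fin, nsmul_eq_mul] at hA
  nlinarith
end

section
/- If φ_1,…,φ_N (N ≤ M) are orthonormal eigenvectors of the correlation operator R with R φ_n = λ_n·φ_n for n = 1,…,N, then the total squared projection error of the snapshots onto the POD space span{φ_1,…,φ_N} equals the sum of the truncated eigenvalues: Σ_{j=1}^{M} ‖y_j − Σ_{n=1}^{N} ⟨y_j, φ_n⟩·φ_n‖² = Σ_{l=N+1}^{M} λ_l. -/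
open RealInnerProductSpace

/-- if `φ_1,…,φ_N` (`N ≤ M`) are orthonormal eigenvectors of the
correlation operator `R` with `R φ_n = λ_n φ_n`, then the total squared projection
error of the snapshots onto `span{φ_1,…,φ_N}` equals the sum of the truncated
eigenvalues: `Σ_j ‖y_j − Σ_n ⟪y_j, φ_n⟫ φ_n‖² = Σ_{l=N+1}^{M} λ_l`. Here
`λ_1 ≥ … ≥ λ_M ≥ 0` lists every nonzero eigenvalue of `R` with multiplicity
(padded with zeros), encoded by the eigenfamily `e`. -/
theorem weighted_rb_stmt12
    {X : Type*} [NormedAddCommGroup X] [InnerProductSpace ℝ X] [FiniteDimensional ℝ X]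
    (M : ℕ) (y : Fin M → X)
    (R : X → X) (hR : ∀ v : X, R v = ∑ j : Fin M, ⟪v, y j⟫ • y j)
    (lam : Fin M → ℝ) (hlam_anti : Antitone lam) (hlam_nonneg : ∀ l, 0 ≤ lam l)
    (e : Fin M → X)
    (he_eig : ∀ l, R (e l) = lam l • e l)
    (he_norm : ∀ l, lam l ≠ 0 → ‖e l‖ = 1)
    (he_orth : ∀ l l', l ≠ l' → ⟪e l, e l'⟫ = 0)
    (he_span : ∀ v : X, (∀ l, ⟪v, e l⟫ = 0) → R v = 0)
    (N : ℕ) (hNM : N ≤ M)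
    (φ : Fin N → X) (hφ : Orthonormal ℝ φ)
    (hφ_eig : ∀ n : Fin N, R (φ n) = lam (Fin.castLE hNM n) • φ n) :
    ∑ j : Fin M, ‖y j - ∑ n : Fin N, ⟪y j, φ n⟫ • φ n‖ ^ 2
      = ∑ l ∈ Finset.univ.filter (fun l : Fin M => N ≤ (l : ℕ)), lam l := by
  have hq : ∀ v : X, ⟪R v, v⟫ = ∑ j, ⟪y j, v⟫ ^ 2 := by
    intro v
    rw [hR, sum_inner]
    refine Finset.sum_congr rfl fun j _ => ?_
    rw [real_inner_smul_left, real_inner_comm, sq]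
  have hker : ∀ v : X, R v = 0 → ∀ j, ⟪y j, v⟫ = 0 := by
    intro v hv j
    have h := hq v
    rw [hv, inner_zero_left] at h
    have h2 := (Finset.sum_eq_zero_iff_of_nonneg (fun j _ => sq_nonneg (⟪y j, v⟫))).1 h.symm j
      (Finset.mem_univ j)
    exact pow_eq_zero_iff (two_ne_zero) |>.1 h2
  have he : ∀ l, ∑ j, ⟪y j, e l⟫ ^ 2 = lam l := by
    intro l
    rw [← hq, he_eig, real_inner_smul_left, real_inner_self_eq_norm_sq]
    by_cases h : lam l = 0
    · simp [h]
    · simp [he_norm l h]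
  have hp : ∀ n, ∑ j, ⟪y j, φ n⟫ ^ 2 = lam (Fin.castLE hNM n) := by
    intro n
    rw [← hq, hφ_eig, real_inner_smul_left, real_inner_self_eq_norm_sq, hφ.1 n]
    simp
  have hy : ∀ j, ‖y j‖ ^ 2 = ∑ l, ⟪y j, e l⟫ ^ 2 := by
    intro j
    have hv : R (y j - ∑ l, ⟪y j, e l⟫ • e l) = 0 := by
      apply he_span
      intro l
      rw [inner_sub_left, sum_inner, Finset.sum_eq_single l]
      · rw [real_inner_smul_left, real_inner_self_eq_norm_sq]
        by_cases h : lam l = 0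
        · have : ⟪y j, e l⟫ = 0 := hker (e l) (by rw [he_eig, h, zero_smul]) j
          simp [this]
        · simp [he_norm l h]
      · intro l' _ hl
        rw [real_inner_smul_left, he_orth l' l hl, mul_zero]
      · simp
    have h := hker _ hv j
    rw [inner_sub_right, inner_sum, real_inner_self_eq_norm_sq, sub_eq_zero] at h
    rw [h]
    refine Finset.sum_congr rfl fun l _ => ?_
    rw [real_inner_smul_right, sq]
  have hproj : ∀ j, ‖y j - ∑ n : Fin N, ⟪y j, φ n⟫ • φ n‖ ^ 2
      = ‖y j‖ ^ 2 - ∑ n, ⟪y j, φ n⟫ ^ 2 := by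
    intro j
    have h1 : ⟪y j, ∑ n : Fin N, ⟪y j, φ n⟫ • φ n⟫ = ∑ n, ⟪y j, φ n⟫ ^ 2 := by
      rw [inner_sum]
      refine Finset.sum_congr rfl fun l _ => ?_
      rw [real_inner_smul_right, sq]
    have h2 : ‖∑ n : Fin N, ⟪y j, φ n⟫ • φ n‖ ^ 2 = ∑ n, ⟪y j, φ n⟫ ^ 2 := by
      rw [← real_inner_self_eq_norm_sq, hφ.inner_sum]
      simp [sq]
    rw [norm_sub_sq_real, h1, h2]
    ring
  have hlow : ∑ n : Fin N, lam (Fin.castLE hNM n)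
      = ∑ l ∈ Finset.univ.filter (fun l : Fin M => ¬ N ≤ (l : ℕ)), lam l := by
    refine Finset.sum_bij (fun n _ => Fin.castLE hNM n) ?_ ?_ ?_ ?_
    · intro n _
      simp
    · intro a _ b _ h
      simpa using h
    · intro l hl
      have hl' : (l : ℕ) < N := by simpa using hl
      exact ⟨⟨l, hl'⟩, Finset.mem_univ _, rfl⟩
    · intros
      rfl
  have htot := Finset.sum_filter_add_sum_filter_not Finset.univ
    (fun l : Fin M => N ≤ (l : ℕ)) lam
  have hA : ∑ j, ‖y j‖ ^ 2 = ∑ l, lam l := by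
    simp_rw [hy]
    rw [Finset.sum_comm]
    simp_rw [he]
  have hB : ∑ j, ∑ n, ⟪y j, φ n⟫ ^ 2 = ∑ n : Fin N, lam (Fin.castLE hNM n) := by
    rw [Finset.sum_comm]
    simp_rw [hp]
  simp_rw [hproj]
  rw [Finset.sum_sub_distrib, hA, hB]
  linarith
end

section
/- (Optimality of the POD basis.) For every orthonormal family φ_1,…,φ_N in X with N ≤ M, the total squared projection error of the snapshots satisfies Σ_{j=1}^{M} ‖y_j − Σ_{n=1}^{N} ⟨y_j, φ_n⟩·φ_n‖² ≥ Σ_{l=N+1}^{M} λ_l; moreover equality is attained when φ_1,…,φ_N are orthonormal eigenvectors of R corresponding to the N largest eigenvalues λ_1,…,λ_N. Hence the minimum over all orthonormal families of size N of the total squared projection error equals Σ_{l=N+1}^{M} λ_l. -/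
open RealInnerProductSpace

theorem pod_err {X : Type*} [NormedAddCommGroup X] [InnerProductSpace ℝ X] {N : ℕ}
    (φ : Fin N → X) (h : Orthonormal ℝ φ) (x : X) :
    ‖x - ∑ n : Fin N, ⟪x, φ n⟫ • φ n‖ ^ 2 = ‖x‖ ^ 2 - ∑ n, ⟪x, φ n⟫ ^ 2 := by
  have h1 : ⟪x, ∑ n : Fin N, ⟪x, φ n⟫ • φ n⟫ = ∑ n, ⟪x, φ n⟫ ^ 2 := by
    rw [inner_sum]
    refine Finset.sum_congr rfl fun n _ => ?_
    rw [inner_smul_right, sq]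
  have h2 : ‖∑ n : Fin N, ⟪x, φ n⟫ • φ n‖ ^ 2 = ∑ n, ⟪x, φ n⟫ ^ 2 := by
    rw [← real_inner_self_eq_norm_sq, h.inner_sum]
    refine Finset.sum_congr rfl fun n _ => ?_
    simp [sq]
  rw [norm_sub_sq_real, h1, h2]
  ring

theorem pod_spec {X : Type*} [NormedAddCommGroup X] [InnerProductSpace ℝ X]
    (M : ℕ) (y : Fin M → X)
    (R : X → X) (hR : ∀ v : X, R v = ∑ j : Fin M, ⟪v, y j⟫ • y j)
    (lam : Fin M → ℝ) (e : Fin M → X)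
    (he_eig : ∀ l, R (e l) = lam l • e l)
    (he_norm : ∀ l, lam l ≠ 0 → ‖e l‖ = 1)
    (he_orth : ∀ l l', l ≠ l' → ⟪e l, e l'⟫ = 0)
    (he_span : ∀ v : X, (∀ l, ⟪v, e l⟫ = 0) → R v = 0) (v : X) :
    ∑ j, ⟪v, y j⟫ ^ 2 = ∑ l, lam l * ⟪v, e l⟫ ^ 2 := by
  have hadd : ∀ a b, R (a - b) = R a - R b := by
    intro a b
    simp [hR, inner_sub_left, sub_smul, Finset.sum_sub_distrib]
  have hsum : ∀ c : Fin M → ℝ, R (∑ l, c l • e l) = ∑ l, c l • R (e l) := by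
    intro c
    simp only [hR, sum_inner, inner_smul_left, Finset.sum_smul, Finset.smul_sum, mul_smul]
    rw [Finset.sum_comm]
    simp
  have h0 := he_span (v - ∑ l, (⟪v, e l⟫ / ⟪e l, e l⟫) • e l) (by
    intro l
    rw [inner_sub_left, sum_inner, Finset.sum_eq_single l]
    · rw [real_inner_smul_left]
      by_cases h : e l = 0
      · simp [h]
      · have : ⟪e l, e l⟫ ≠ 0 := by simpa using h
        field_simp
        ring
    · intro b _ hb
      rw [real_inner_smul_left, he_orth b l hb, mul_zero]
    · simp)
  rw [hadd, hsum, sub_eq_zero] at h0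
  have h1 : ⟪R v, v⟫ = ∑ j, ⟪v, y j⟫ ^ 2 := by
    rw [hR, sum_inner]
    refine Finset.sum_congr rfl fun n _ => ?_
    rw [real_inner_smul_left, real_inner_comm, sq]
  rw [← h1, h0, sum_inner]
  refine Finset.sum_congr rfl fun l _ => ?_
  rw [he_eig, real_inner_smul_left, real_inner_smul_left, real_inner_comm]
  by_cases h : lam l = 0
  · simp [h]
  · rw [real_inner_self_eq_norm_sq, he_norm l h]
    ring

theorem pod_trace {X : Type*} [NormedAddCommGroup X] [InnerProductSpace ℝ X]
    [FiniteDimensional ℝ X] (M : ℕ) (y : Fin M → X)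
    (lam : Fin M → ℝ) (e : Fin M → X)
    (he_norm : ∀ l, lam l ≠ 0 → ‖e l‖ = 1)
    (hs : ∀ v, ∑ j, ⟪v, y j⟫ ^ 2 = ∑ l, lam l * ⟪v, e l⟫ ^ 2) :
    ∑ j, ‖y j‖ ^ 2 = ∑ l, lam l := by
  let b := stdOrthonormalBasis ℝ X
  have hb : ∀ x : X, ‖x‖ ^ 2 = ∑ i, ⟪b i, x⟫ ^ 2 := by
    intro x
    rw [← b.sum_sq_norm_inner_right x]
    simp
  calc ∑ j, ‖y j‖ ^ 2 = ∑ i, ∑ j, ⟪b i, y j⟫ ^ 2 := by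
        rw [Finset.sum_comm]
        exact Finset.sum_congr rfl fun j _ => hb _
    _ = ∑ l, lam l * ‖e l‖ ^ 2 := by
        simp only [hs, hb, Finset.mul_sum]
        rw [Finset.sum_comm]
    _ = _ := by
        refine Finset.sum_congr rfl fun l _ => ?_
        by_cases h : lam l = 0
        · simp [h]
        · rw [he_norm l h]; ring

theorem pod_head {M N : ℕ} (hNM : N ≤ M) (f : Fin M → ℝ) :
    ∑ n : Fin N, f (Fin.castLE hNM n) = ∑ l : Fin M, if (l : ℕ) < N then f l else 0 := by
  obtain ⟨k, rfl⟩ := Nat.exists_eq_add_of_le hNM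
  rw [Fin.sum_univ_add]
  simp
  rfl

theorem pod_split {M N : ℕ} (hNM : N ≤ M) (f : Fin M → ℝ) :
    ∑ l ∈ Finset.univ.filter (fun l : Fin M => N ≤ (l : ℕ)), f l
      = ∑ l, f l - ∑ n : Fin N, f (Fin.castLE hNM n) := by
  rw [pod_head, Finset.sum_filter, ← Finset.sum_sub_distrib]
  refine Finset.sum_congr rfl fun l _ => ?_
  by_cases h : (l : ℕ) < N
  · simp [h, not_le.mpr h]
  · simp [h, not_lt.mp h]

theorem pod_upper {X : Type*} [NormedAddCommGroup X] [InnerProductSpace ℝ X]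
    (M : ℕ) (lam : Fin M → ℝ) (hlam_anti : Antitone lam) (hlam_nonneg : ∀ l, 0 ≤ lam l)
    (e : Fin M → X)
    (he_norm : ∀ l, lam l ≠ 0 → ‖e l‖ = 1)
    (he_orth : ∀ l l', l ≠ l' → ⟪e l, e l'⟫ = 0)
    (N : ℕ) (hNM : N ≤ M) (φ : Fin N → X) (hφ : Orthonormal ℝ φ) :
    ∑ n, ∑ l, lam l * ⟪φ n, e l⟫ ^ 2 ≤ ∑ n : Fin N, lam (Fin.castLE hNM n) := by
  obtain ⟨μ, hμ0, hμ1, hμ2⟩ : ∃ μ : ℝ, 0 ≤ μ ∧ (∀ l : Fin M, (l : ℕ) < N → μ ≤ lam l) ∧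
      (∀ l : Fin M, N ≤ (l : ℕ) → lam l ≤ μ) := by
    by_cases h : N < M
    · refine ⟨lam ⟨N, h⟩, hlam_nonneg _, fun l hl => hlam_anti ?_, fun l hl => hlam_anti ?_⟩
      · exact Fin.le_def.mpr hl.le
      · exact Fin.le_def.mpr hl
    · exact ⟨0, le_rfl, fun l _ => hlam_nonneg l, fun l hl => by have := l.2; omega⟩
  set w : Fin M → ℝ := fun l => if lam l = 0 then 0 else ∑ n, ⟪φ n, e l⟫ ^ 2 with hw
  have hw0 : ∀ l, 0 ≤ w l := by
    intro l
    simp only [hw]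
    split_ifs
    · exact le_rfl
    · exact Finset.sum_nonneg fun n _ => sq_nonneg _
  have hw1 : ∀ l, w l ≤ 1 := by
    intro l
    simp only [hw]
    split_ifs with h
    · exact zero_le_one
    · have := hφ.sum_inner_products_le (e l) (s := Finset.univ)
      rw [he_norm l h] at this
      simpa using this
  have hon : Orthonormal ℝ (fun l : {l : Fin M // lam l ≠ 0} => e l) :=
    ⟨fun l => he_norm l l.2, fun a b hab => he_orth _ _ fun h => hab (Subtype.ext h)⟩
  have hwN : ∑ l, w l ≤ N := by
    have h1 : ∑ l, w l = ∑ n, ∑ l : {l : Fin M // lam l ≠ 0}, ⟪φ n, e l⟫ ^ 2 := by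
      rw [Finset.sum_comm]
      rw [← Finset.sum_subtype (Finset.univ.filter fun l : Fin M => lam l ≠ 0) (by simp)
        (fun l => ∑ n, ⟪φ n, e l⟫ ^ 2), Finset.sum_filter]
      refine Finset.sum_congr rfl fun l _ => ?_
      simp only [hw]
      by_cases h : lam l = 0 <;> simp [h]
    rw [h1]
    calc _ ≤ ∑ n : Fin N, (1 : ℝ) := by
          refine Finset.sum_le_sum fun n _ => ?_
          have := hon.sum_inner_products_le (φ n) (s := Finset.univ)
          rw [hφ.1 n] at this
          simpa [real_inner_comm] using this
      _ = N := by simp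
  have hL : ∑ n, ∑ l, lam l * ⟪φ n, e l⟫ ^ 2 = ∑ l, lam l * w l := by
    rw [Finset.sum_comm]
    refine Finset.sum_congr rfl fun l _ => ?_
    simp only [hw]
    by_cases h : lam l = 0 <;> simp [h, Finset.mul_sum]
  have hpt : ∑ l, (lam l - μ) * w l ≤ ∑ l : Fin M, if (l : ℕ) < N then lam l - μ else 0 := by
    refine Finset.sum_le_sum fun l _ => ?_
    split_ifs with h
    · nlinarith [hμ1 l h, hw1 l]
    · nlinarith [hμ2 l (not_lt.mp h), hw0 l]
  rw [← pod_head hNM (fun l => lam l - μ)] at hpt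
  simp only [sub_mul, Finset.sum_sub_distrib, ← Finset.mul_sum] at hpt
  simp at hpt
  rw [hL]
  nlinarith [mul_le_mul_of_nonneg_left hwN hμ0]

/-- optimality of the POD basis: for every orthonormal family
`φ_1,…,φ_N` (`N ≤ M`) the total squared projection error satisfies
`Σ_j ‖y_j − Σ_n ⟪y_j, φ_n⟫ φ_n‖² ≥ Σ_{l=N+1}^{M} λ_l`, with equality when
`φ_1,…,φ_N` are orthonormal eigenvectors of `R` for the `N` largest eigenvalues
`λ_1,…,λ_N`; hence (given that such eigenvectors exist) the minimum over all
orthonormal families of size `N` of the total squared projection error equals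
`Σ_{l=N+1}^{M} λ_l`. Here `R v = Σ_j ⟪v, y_j⟫ y_j` and `λ_1 ≥ … ≥ λ_M ≥ 0` lists
every nonzero eigenvalue of `R` with multiplicity (padded with zeros), encoded by
the eigenfamily `e`. -/
theorem weighted_rb_stmt13
    {X : Type*} [NormedAddCommGroup X] [InnerProductSpace ℝ X] [FiniteDimensional ℝ X]
    (M : ℕ) (y : Fin M → X)
    (R : X → X) (hR : ∀ v : X, R v = ∑ j : Fin M, ⟪v, y j⟫ • y j)
    (lam : Fin M → ℝ) (hlam_anti : Antitone lam) (hlam_nonneg : ∀ l, 0 ≤ lam l)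
    (e : Fin M → X)
    (he_eig : ∀ l, R (e l) = lam l • e l)
    (he_norm : ∀ l, lam l ≠ 0 → ‖e l‖ = 1)
    (he_orth : ∀ l l', l ≠ l' → ⟪e l, e l'⟫ = 0)
    (he_span : ∀ v : X, (∀ l, ⟪v, e l⟫ = 0) → R v = 0)
    (N : ℕ) (hNM : N ≤ M)
    (hex : ∃ φ : Fin N → X, Orthonormal ℝ φ ∧
      ∀ n : Fin N, R (φ n) = lam (Fin.castLE hNM n) • φ n) :
    (∀ φ : Fin N → X, Orthonormal ℝ φ →
      ∑ l ∈ Finset.univ.filter (fun l : Fin M => N ≤ (l : ℕ)), lam l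
        ≤ ∑ j : Fin M, ‖y j - ∑ n : Fin N, ⟪y j, φ n⟫ • φ n‖ ^ 2) ∧
    (∀ φ : Fin N → X, Orthonormal ℝ φ →
      (∀ n : Fin N, R (φ n) = lam (Fin.castLE hNM n) • φ n) →
      ∑ j : Fin M, ‖y j - ∑ n : Fin N, ⟪y j, φ n⟫ • φ n‖ ^ 2
        = ∑ l ∈ Finset.univ.filter (fun l : Fin M => N ≤ (l : ℕ)), lam l) ∧
    IsLeast
      {S : ℝ | ∃ φ : Fin N → X, Orthonormal ℝ φ ∧
        S = ∑ j : Fin M, ‖y j - ∑ n : Fin N, ⟪y j, φ n⟫ • φ n‖ ^ 2}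
      (∑ l ∈ Finset.univ.filter (fun l : Fin M => N ≤ (l : ℕ)), lam l) := by
  have hs := pod_spec M y R hR lam e he_eig he_norm he_orth he_span
  have ht := pod_trace M y lam e he_norm hs
  have herr : ∀ φ : Fin N → X, Orthonormal ℝ φ →
      ∑ j : Fin M, ‖y j - ∑ n : Fin N, ⟪y j, φ n⟫ • φ n‖ ^ 2
        = ∑ l, lam l - ∑ n, ∑ j, ⟪φ n, y j⟫ ^ 2 := by
    intro φ hφ
    simp only [pod_err φ hφ, Finset.sum_sub_distrib, ht]
    rw [Finset.sum_comm]
    simp only [real_inner_comm]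
  have hA : ∀ φ : Fin N → X, Orthonormal ℝ φ →
      ∑ l ∈ Finset.univ.filter (fun l : Fin M => N ≤ (l : ℕ)), lam l
        ≤ ∑ j : Fin M, ‖y j - ∑ n : Fin N, ⟪y j, φ n⟫ • φ n‖ ^ 2 := by
    intro φ hφ
    rw [herr φ hφ, pod_split hNM]
    simp only [hs]
    have := pod_upper M lam hlam_anti hlam_nonneg e he_norm he_orth N hNM φ hφ
    linarith
  have hB : ∀ φ : Fin N → X, Orthonormal ℝ φ →
      (∀ n : Fin N, R (φ n) = lam (Fin.castLE hNM n) • φ n) →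
      ∑ j : Fin M, ‖y j - ∑ n : Fin N, ⟪y j, φ n⟫ • φ n‖ ^ 2
        = ∑ l ∈ Finset.univ.filter (fun l : Fin M => N ≤ (l : ℕ)), lam l := by
    intro φ hφ hE
    rw [herr φ hφ, pod_split hNM]
    congr 1
    refine Finset.sum_congr rfl fun n _ => ?_
    have h1 : ⟪R (φ n), φ n⟫ = ∑ j, ⟪φ n, y j⟫ ^ 2 := by
      rw [hR, sum_inner]
      refine Finset.sum_congr rfl fun j _ => ?_
      rw [real_inner_smul_left, real_inner_comm, sq]
    rw [← h1, hE, real_inner_smul_left, real_inner_self_eq_norm_sq, hφ.1 n]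
    ring
  refine ⟨hA, hB, ?_, ?_⟩
  · obtain ⟨φ, hφ, hE⟩ := hex
    exact ⟨φ, hφ, (hB φ hφ hE).symm⟩
  · rintro S ⟨φ, hφ, rfl⟩
    exact hA φ hφ
end
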